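/- Let T=(Q,A,B,→,O,H) be a finite non-blocking alternating transition system, q₀∈Q, ∏:Q→2^P a valuation function, φ an LTL₋X(P) formula, 𝒜_φ=(S,{x₀},2^P,→_{𝒜_φ},F) a total Büchi automaton accepting exactly the infinite words over 2^P satisfying φ, and f₀ a control strategy of T such that every σ∈Out_T(q₀,f₀) satisfies φ w.r.t. ∏. Let f_T := f₀∘Υ_T and let T_fin(𝒜^φ_{T,q₀},f_T)=(S_f,A,→_f,lab) be the accepting transition system w.r.t. 𝒜^φ_{T,q₀} and f_T. Then the state set S_f is finite and non-empty. -/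

import Mathlib

/-! Common definitions: alternating transition systems, control strategies and
their outcomes, LTL₋X, reactive plans, Büchi automata, product automata,
the `ReN` function, and the accepting transition system `T_fin`.
All infinite sequences are modeled as functions `ℕ → X` (0-indexed: index `i`
corresponds to position `i+1` of the paper), finite non-empty sequences as
`List X`. -/

/-- Alternating transition system with states `Q`, control labels `A`,
disturbance labels `B` and observations `O`. -/
structure ATS (Q A B O : Type*) where
  trans : Q → A → B → Q → Prop
  obs : Q → O

namespace ATS

variable {Q A B O : Type*}

/-- `T` is non-blocking. -/
def NonBlocking (T : ATS Q A B O) : Prop :=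
  ∀ q a b, ∃ q', T.trans q a b q'

/-- `σ` is an (infinite) trajectory of `T`. -/
def Traj (T : ATS Q A B O) (σ : ℕ → Q) : Prop :=
  ∀ i, ∃ a b, T.trans (σ i) a b (σ (i + 1))

end ATS

/-- The prefix `σ[1,n]` (first `n` entries) of an infinite sequence. -/
def prefixSeq {X : Type*} (σ : ℕ → X) (n : ℕ) : List X :=
  (List.range n).map σ

/-- `s ∈ Out⁺_T(q,f)` : `s` is a (non-empty) finite outcome of the control
strategy `f` from `q`. -/
def FinOutcome {Q A B O : Type*} (T : ATS Q A B O) (f : List Q → A) (q : Q)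
    (s : List Q) : Prop :=
  s ≠ [] ∧ s.head? = some q ∧
    ∀ (i : ℕ) x y, s[i]? = some x → s[i + 1]? = some y →
      ∃ b, T.trans x (f (s.take (i + 1))) b y

/-- `σ ∈ Out_T(q,f)` : `σ` is an infinite outcome of the control strategy `f`
from `q`. -/
def InfOutcome {Q A B O : Type*} (T : ATS Q A B O) (f : List Q → A) (q : Q)
    (σ : ℕ → Q) : Prop :=
  σ 0 = q ∧ ∀ i, ∃ b, T.trans (σ i) (f (prefixSeq σ (i + 1))) b (σ (i + 1))

/-- LTL₋X formulas over atomic propositions `P`. -/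
inductive LTL (P : Type*) where
  | atom : P → LTL P
  | neg : LTL P → LTL P
  | conj : LTL P → LTL P → LTL P
  | until_ : LTL P → LTL P → LTL P

/-- Satisfaction of an LTL₋X formula at position `i` (0-indexed) of an infinite
word `w` over `2^P`. -/
def LTL.SatAt {P : Type*} (w : ℕ → Set P) : ℕ → LTL P → Prop
  | i, .atom p => p ∈ w i
  | i, .neg φ => ¬ LTL.SatAt w i φ
  | i, .conj φ ψ => LTL.SatAt w i φ ∧ LTL.SatAt w i ψ
  | i, .until_ φ ψ =>
      ∃ j, i ≤ j ∧ LTL.SatAt w j ψ ∧ ∀ k, i ≤ k → k < j → LTL.SatAt w k φ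

/-- `w ⊨ φ`. -/
def LTL.Sat {P : Type*} (w : ℕ → Set P) (φ : LTL P) : Prop :=
  LTL.SatAt w 0 φ

/-- `σ ⊨_∏ φ` for an infinite sequence of states and valuation `Pi`. -/
def SatTraj {Q P : Type*} (Pi : Q → Set P) (σ : ℕ → Q) (φ : LTL P) : Prop :=
  LTL.Sat (fun i => Pi (σ i)) φ

/-- A reactive plan with plan states `1,…,k` modeled as `Fin k`
(plan state 1 is `⟨0, hk⟩`), world-state labels `lab`, actions `act` and
successor sets `N`. -/
structure ReactivePlan (Q A : Type*) where
  k : ℕ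
  hk : 0 < k
  lab : Fin k → Q
  act : Fin k → A
  N : Fin k → Set (Fin k)

namespace ReactivePlan

variable {Q A : Type*}

/-- Plan state 1. -/
def one (RP : ReactivePlan Q A) : Fin RP.k := ⟨0, RP.hk⟩

/-- `σ` is a trajectory generated by `RP`. -/
def Traj (RP : ReactivePlan Q A) (σ : ℕ → Q) : Prop :=
  ∃ σN : ℕ → Fin RP.k, σN 0 = RP.one ∧
    ∀ j, σN (j + 1) ∈ RP.N (σN j) ∧ RP.lab (σN j) = σ j

/-- `s` is a finite path of `RP`. -/
def IsPath (RP : ReactivePlan Q A) (s : List (Fin RP.k)) : Prop :=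
  1 < s.length ∧ ∀ (i : ℕ) x y, s[i]? = some x → s[i + 1]? = some y → y ∈ RP.N x

/-- `RP` satisfies `φ` w.r.t. the valuation `Pi`. -/
def SatPlan {P : Type*} (RP : ReactivePlan Q A) (φ : LTL P) (Pi : Q → Set P) :
    Prop :=
  (∃ σ, RP.Traj σ) ∧ ∀ σ, RP.Traj σ → SatTraj Pi σ φ

/-- `RP` is a reactive plan of the alternating transition system `T`. -/
def OfATS {B O : Type*} (RP : ReactivePlan Q A) (T : ATS Q A B O) : Prop :=
  ∀ i, {x | ∃ j ∈ RP.N i, RP.lab j = x} =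
    {q' | ∃ b, T.trans (RP.lab i) (RP.act i) b q'}

/-- `sN` is a plan-state sequence matching the world-state sequence `s`:
it has the same length, starts in plan state 1, consecutive plan states are
successors, and labels agree with `s`. -/
def PlanMatch (RP : ReactivePlan Q A) (s : List Q) (sN : List (Fin RP.k)) :
    Prop :=
  sN.length = s.length ∧ sN.head? = some RP.one ∧
    (∀ (j : ℕ) x y, sN[j]? = some x → sN[j + 1]? = some y → y ∈ RP.N x) ∧
    (∀ (j : ℕ) x y, sN[j]? = some x → s[j]? = some y → y = RP.lab x)

/-- `f` is the control strategy generated by `RP`: on a sequence matched by a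
plan-state path it returns the action of the last plan state, otherwise the
action of plan state 1. -/
def IsGenStrategy (RP : ReactivePlan Q A) (f : List Q → A) : Prop :=
  ∀ s : List Q,
    (∀ sN x, RP.PlanMatch s sN → sN.getLast? = some x → f s = RP.act x) ∧
    ((¬ ∃ sN, RP.PlanMatch s sN) → f s = RP.act RP.one)

end ReactivePlan

/-- Büchi automaton with states `S` and input alphabet `L`. -/
structure Buchi (S L : Type*) where
  init : Set S
  trans : S → L → S → Prop
  acc : Set S

namespace Buchi

variable {S L : Type*}

/-- `σ` is a run accepted by `𝒜`. -/
def AccRun (𝒜 : Buchi S L) (σ : ℕ → S) : Prop :=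
  σ 0 ∈ 𝒜.init ∧ (∀ i, ∃ l, 𝒜.trans (σ i) l (σ (i + 1))) ∧
    ∃ x ∈ 𝒜.acc, ∀ n, ∃ m, n ≤ m ∧ σ m = x

/-- The infinite word `w` is accepted by `𝒜`. -/
def AccWord (𝒜 : Buchi S L) (w : ℕ → L) : Prop :=
  ∃ σ : ℕ → S, 𝒜.AccRun σ ∧ ∀ i, 𝒜.trans (σ i) (w i) (σ (i + 1))

/-- `𝒜` is total. -/
def Total (𝒜 : Buchi S L) : Prop :=
  (∃ x₀, 𝒜.init = {x₀}) ∧ ∀ x l, ∃! x', 𝒜.trans x l x'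

end Buchi

/-- Transition relation of the product automaton `𝒜^φ_{T,q₀}` on `Q × S`. -/
def ProdTrans {Q A B O S P : Type*} (T : ATS Q A B O) (𝒜 : Buchi S (Set P))
    (Pi : Q → Set P) : (Q × S) → A → B → (Q × S) → Prop :=
  fun p a b p' => T.trans p.1 a b p'.1 ∧ 𝒜.trans p.2 (Pi p.1) p'.2

/-- The product automaton viewed as an alternating transition system
(so that `Out`-sets for it are the ones of this system). -/
def ProdATS {Q A B O S P : Type*} (T : ATS Q A B O) (𝒜 : Buchi S (Set P))
    (Pi : Q → Set P) : ATS (Q × S) A B (Q × S) :=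
  { trans := ProdTrans T 𝒜 Pi, obs := id }

/-- The accepting set `F_T = Q × F` of the product automaton. -/
def ProdAcc (Q : Type*) {S P : Type*} (𝒜 : Buchi S (Set P)) : Set (Q × S) :=
  {p | p.2 ∈ 𝒜.acc}

/-- `σT` is a run accepted by the product automaton `𝒜^φ_{T,q₀}`. -/
def ProdAccRun {Q A B O S P : Type*} (T : ATS Q A B O) (𝒜 : Buchi S (Set P))
    (Pi : Q → Set P) (q₀ : Q) (x₀ : S) (σT : ℕ → Q × S) : Prop :=
  σT 0 = (q₀, x₀) ∧ (∀ i, ∃ a b, ProdTrans T 𝒜 Pi (σT i) a b (σT (i + 1))) ∧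
    ∃ p ∈ ProdAcc Q 𝒜, ∀ n, ∃ m, n ≤ m ∧ σT m = p

/-- The induced control strategy `f_T = f₀ ∘ Υ_T` of the product automaton. -/
def prodStrategy {Q A S : Type*} (f₀ : List Q → A) : List (Q × S) → A :=
  fun s => f₀ (s.map Prod.fst)

/-- `ReN` for finite sequences: the least index carrying a repeated occurrence
of an accepting state (`⊤` if there is none). -/
noncomputable def ReNList {X : Type*} (FT : Set X) (s : List X) : ℕ∞ :=
  sInf {e : ℕ∞ | ∃ n : ℕ, e = (n : ℕ∞) ∧
    ∃ i < n, ∃ y, s[i]? = some y ∧ s[n]? = some y ∧ y ∈ FT}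

/-- `ReN` for infinite sequences. -/
noncomputable def ReNFun {X : Type*} (FT : Set X) (σ : ℕ → X) : ℕ∞ :=
  sInf {e : ℕ∞ | ∃ n : ℕ, e = (n : ℕ∞) ∧ ∃ i < n, σ i = σ n ∧ σ n ∈ FT}

/-- The state set `S_f` of the accepting transition system `T_fin`: finite
outcomes of `f_T` from `(q₀,x₀)` in which every accepting state occurs at most
once. -/
def TfinStates {Q A B O S P : Type*} (T : ATS Q A B O) (𝒜 : Buchi S (Set P))
    (Pi : Q → Set P) (f₀ : List Q → A) (q₀ : Q) (x₀ : S) :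
    Set (List (Q × S)) :=
  {s | FinOutcome (ProdATS T 𝒜 Pi) (prodStrategy f₀) (q₀, x₀) s ∧
    ReNList (ProdAcc Q 𝒜) s = ⊤}

/-- The transition relation `→_f` of the accepting transition system `T_fin`
(with `step` the transition relation of the product automaton). -/
def TfinStep {X A' B' : Type*} (FT : Set X) (step : X → A' → B' → X → Prop)
    (fT : List X → A') (s : List X) (a : A') (s' : List X) : Prop :=
  a = fT s ∧ ∃ (p : X) (b : B') (lst : X), s.getLast? = some lst ∧
    step lst a b p ∧
    (s' = s ++ [p] ∨
      (ReNList FT (s ++ [p]) ≠ ⊤ ∧ s' ≠ s ++ [p] ∧ s' <+: (s ++ [p]) ∧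
        s'.getLast? = some p))

/-- `σT` is a trajectory of the accepting transition system `T_fin`. -/
def TfinTraj {X A' B' : Type*} (Sf : Set (List X)) (FT : Set X)
    (step : X → A' → B' → X → Prop) (fT : List X → A') (init : X)
    (σT : ℕ → X) : Prop :=
  ∃ seq : ℕ → List X, seq 0 = [init] ∧
    ∀ i, seq i ∈ Sf ∧ (seq i).getLast? = some (σT i) ∧
      ∃ a, TfinStep FT step fT (seq i) a (seq (i + 1))

/-- A form of König's lemma: infinitely many words over a finite alphabet have a common
infinite branch, each finite prefix of which begins infinitely many of the words. -/
theorem exists_prefixSeq_infinite_extensions {X : Type*} [Finite X] {W : Set (List X)}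
    (hW : W.Infinite) :
    ∃ σ : ℕ → X, ∀ n, {t ∈ W | prefixSeq σ n <+: t}.Infinite := by
  have step : ∀ s : List X, {t ∈ W | s <+: t}.Infinite →
      ∃ p, {t ∈ W | s ++ [p] <+: t}.Infinite := by
    intro s hs
    by_contra! hfin
    refine hs (((Set.finite_singleton s).union (Set.finite_iUnion hfin)).subset ?_)
    rintro t ⟨ht, u, rfl⟩
    cases u with
    | nil => simp
    | cons p u => exact Or.inr (Set.mem_iUnion.2 ⟨p, ht, u, by simp⟩)
  choose next hnext using step
  let branch : ℕ → {s : List X // {t ∈ W | s <+: t}.Infinite} := fun n =>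
    Nat.rec ⟨[], by simpa using hW⟩ (fun _ s => ⟨s.1 ++ [next s.1 s.2], hnext s.1 s.2⟩) n
  refine ⟨fun n => next (branch n).1 (branch n).2, fun n => ?_⟩
  have hbranch : prefixSeq (fun n => next (branch n).1 (branch n).2) n = (branch n).1 := by
    induction n with
    | zero => rfl
    | succ n ih =>
      rw [prefixSeq, List.range_succ, List.map_append]
      exact congrArg (· ++ _) ih
  rw [hbranch]
  exact (branch n).2

theorem prefixSeq_getElem? {X : Type*} (σ : ℕ → X) {n i : ℕ} (hi : i < n) :
    (prefixSeq σ n)[i]? = some (σ i) := by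
  simp [prefixSeq, hi]

theorem getElem?_of_prefixSeq_prefix {X : Type*} {σ : ℕ → X} {n i : ℕ} {t : List X}
    (h : prefixSeq σ n <+: t) (hi : i < n) : t[i]? = some (σ i) := by
  obtain ⟨u, rfl⟩ := h
  rw [List.getElem?_append_left (by simpa [prefixSeq] using hi), prefixSeq_getElem? σ hi]

theorem take_of_prefixSeq_prefix {X : Type*} {σ : ℕ → X} {n i : ℕ} {t : List X}
    (h : prefixSeq σ n <+: t) (hi : i ≤ n) : t.take i = prefixSeq σ i := by
  obtain ⟨u, rfl⟩ := h
  rw [List.take_append_of_le_length (by simpa [prefixSeq] using hi)]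
  simp [prefixSeq, ← List.map_take, List.take_range, hi]

theorem ReNList_eq_top_iff {X : Type*} {FT : Set X} {s : List X} :
    ReNList FT s = ⊤ ↔
      ∀ n : ℕ, ∀ i < n, ∀ y, s[i]? = some y → s[n]? = some y → y ∉ FT := by
  rw [ReNList, sInf_eq_top]
  constructor
  · intro h n i hi y hy hy' hF
    exact ENat.natCast_ne_top n (h n ⟨n, rfl, i, hi, y, hy, hy', hF⟩)
  · rintro h _ ⟨n, rfl, i, hi, y, hy, hy', hF⟩
    exact absurd hF (h n i hi y hy hy')

/-- An infinite sequence whose prefixes all extend to finite outcomes is an infinite outcome. -/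
theorem InfOutcome.of_forall_prefix {Q A B O : Type*} {T : ATS Q A B O} {f : List Q → A}
    {q : Q} {σ : ℕ → Q} (h : ∀ n, ∃ t, FinOutcome T f q t ∧ prefixSeq σ n <+: t) :
    InfOutcome T f q σ := by
  constructor
  · obtain ⟨t, ⟨-, hhead, -⟩, hpre⟩ := h 1
    have h0 := getElem?_of_prefixSeq_prefix hpre one_pos
    rw [List.head?_eq_getElem?, h0] at hhead
    exact Option.some.inj hhead
  · intro i
    obtain ⟨t, ⟨-, -, hstep⟩, hpre⟩ := h (i + 2)
    rw [← take_of_prefixSeq_prefix hpre (Nat.le_succ (i + 1))]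
    exact hstep i _ _ (getElem?_of_prefixSeq_prefix hpre (by omega))
      (getElem?_of_prefixSeq_prefix hpre (by omega))

theorem InfOutcome.fst {Q A B O S P : Type*} {T : ATS Q A B O} {𝒜 : Buchi S (Set P)}
    {Pi : Q → Set P} {f₀ : List Q → A} {q₀ : Q} {x₀ : S} {σ : ℕ → Q × S}
    (h : InfOutcome (ProdATS T 𝒜 Pi) (prodStrategy f₀) (q₀, x₀) σ) :
    InfOutcome T f₀ q₀ (fun i => (σ i).1) := by
  refine ⟨congrArg Prod.fst h.1, fun i => ?_⟩
  obtain ⟨b, hb, -⟩ := h.2 i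
  refine ⟨b, ?_⟩
  simpa [prodStrategy, prefixSeq, Function.comp_def] using hb

/-- A total Büchi automaton has at most one run on a given word from a given state. -/
theorem Buchi.Total.run_unique {S L : Type*} {𝒜 : Buchi S L} (htot : 𝒜.Total) {w : ℕ → L}
    {ρ τ : ℕ → S} (h0 : ρ 0 = τ 0) (hρ : ∀ i, 𝒜.trans (ρ i) (w i) (ρ (i + 1)))
    (hτ : ∀ i, 𝒜.trans (τ i) (w i) (τ (i + 1))) (i : ℕ) : ρ i = τ i := by
  induction i with
  | zero => exact h0
  | succ i ih => exact (htot.2 (τ i) (w i)).unique (ih ▸ hρ i) (hτ i)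

theorem singleton_mem_TfinStates {Q A B O S P : Type*} (T : ATS Q A B O)
    (𝒜 : Buchi S (Set P)) (Pi : Q → Set P) (f₀ : List Q → A) (q₀ : Q) (x₀ : S) :
    [(q₀, x₀)] ∈ TfinStates T 𝒜 Pi f₀ q₀ x₀ := by
  refine ⟨⟨by simp, rfl, fun i x y _ hy => by simp at hy⟩, ReNList_eq_top_iff.2 ?_⟩
  intro n i hi y _ hy
  obtain ⟨n, rfl⟩ : ∃ m, n = m + 1 := ⟨n - 1, by omega⟩
  simp at hy

/-- Lemma 5.11(1): the state set `S_f` of the accepting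
transition system `T_fin` is finite and non-empty. -/
theorem stmt13 {Q A B O S P : Type*} [Finite Q] [Finite A] [Finite B]
    [Finite S] [Finite P]
    (T : ATS Q A B O) (hnb : T.NonBlocking) (q₀ : Q)
    (Pi : Q → Set P) (φ : LTL P)
    (𝒜 : Buchi S (Set P)) (x₀ : S) (hinit : 𝒜.init = {x₀})
    (htot : 𝒜.Total)
    (hacc : ∀ w : ℕ → Set P, 𝒜.AccWord w ↔ LTL.Sat w φ)
    (f₀ : List Q → A)
    (hsat : ∀ σ : ℕ → Q, InfOutcome T f₀ q₀ σ → SatTraj Pi σ φ) :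
    (TfinStates T 𝒜 Pi f₀ q₀ x₀).Finite ∧
      (TfinStates T 𝒜 Pi f₀ q₀ x₀).Nonempty := by
  refine ⟨Set.not_infinite.1 fun hinf => ?_, _, singleton_mem_TfinStates T 𝒜 Pi f₀ q₀ x₀⟩
  obtain ⟨σ, hσ⟩ := exists_prefixSeq_infinite_extensions hinf
  have hout : InfOutcome (ProdATS T 𝒜 Pi) (prodStrategy f₀) (q₀, x₀) σ :=
    InfOutcome.of_forall_prefix fun n =>
      let ⟨t, ht, hpre⟩ := (hσ n).nonempty
      ⟨t, ht.1, hpre⟩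
  obtain ⟨ρ, ⟨hρ0, -, x, hx, hxinf⟩, hρ⟩ := (hacc _).2 (hsat _ hout.fst)
  have hρσ : ∀ i, ρ i = (σ i).2 := by
    refine htot.run_unique ?_ hρ fun i => ?_
    · rw [hinit] at hρ0
      rw [hout.1]
      exact hρ0
    · obtain ⟨b, -, hb⟩ := hout.2 i
      exact hb
  have hocc : {m | ρ m = x}.Infinite :=
    Set.infinite_of_forall_exists_gt fun n =>
      let ⟨m, hm, hmx⟩ := hxinf (n + 1)
      ⟨m, hmx, hm⟩
  obtain ⟨i, -, n, hn, hin, heq⟩ := hocc.exists_lt_map_eq_of_mapsTo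
    (f := σ) (t := Set.univ) (fun _ _ => Set.mem_univ _) Set.finite_univ
  obtain ⟨t, ht, hpre⟩ := (hσ (n + 1)).nonempty
  refine ReNList_eq_top_iff.1 ht.2 n i hin (σ n) ?_
    (getElem?_of_prefixSeq_prefix hpre n.lt_succ_self) ?_
  · rw [getElem?_of_prefixSeq_prefix hpre (by omega), heq]
  · change (σ n).2 ∈ 𝒜.acc
    rw [← hρσ, show ρ n = x from hn]
    exact hx
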